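/- Let K be an algebraically closed field and let (A, tr) and (B, tr) be finite-dimensional associative K-algebras with trace, each simple as an algebra with trace. If A and B satisfy the same trace polynomial identities, then there is an isomorphism of algebras with trace between A and B, i.e., a bijective K-linear multiplicative map φ : A → B with φ(tr(a)) = tr(φ(a)) for all a ∈ A. -/

import Mathlib

/-!
STATEMENT 11: Let K be an algebraically closed field and let (A, tr) and (B, tr) be
finite-dimensional associative K-algebras with trace, each simple as an algebra with trace.
If A and B satisfy the same trace polynomial identities, then there is an isomorphism of
algebras with trace between A and B.
-/

/-- Terms over the signature `Ω_tr = {μ, tr}` in the variables `X = ℕ`: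
one binary function symbol `μ` and one unary function symbol `tr`. -/
inductive TraceTerm where
  | var : ℕ → TraceTerm
  | tr : TraceTerm → TraceTerm
  | mu : TraceTerm → TraceTerm → TraceTerm

/-- The realization `t^A(v)` of a trace term `t` in `A` under the evaluation `v` of the
variables, interpreting `μ` as the multiplication of `A` and `tr` as the map `trA`. -/
def TraceTerm.eval {A : Type*} [Mul A] (trA : A → A) (v : ℕ → A) : TraceTerm → A
  | var n => v n
  | tr t => trA (t.eval trA v)
  | mu s t => s.eval trA v * t.eval trA v

/-- `f`, a finitely supported `K`-linear combination of trace terms (a trace polynomial),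
is a trace polynomial identity of `(A, trA)`. -/
def IsTracePI {K A : Type*} [Field K] [NonUnitalRing A] [Module K A]
    (trA : A →ₗ[K] A) (f : TraceTerm →₀ K) : Prop :=
  ∀ v : ℕ → A, (f.sum fun t c => c • TraceTerm.eval trA v t) = 0

/-- `I` is a two-sided ideal of `A`. -/
def IsIdeal {K A : Type*} [Field K] [NonUnitalRing A] [Module K A]
    (I : Submodule K A) : Prop :=
  ∀ a ∈ I, ∀ b : A, a * b ∈ I ∧ b * a ∈ I

/-- `(A, trA)` is simple as an algebra with trace: `A·A ≠ 0` and the only two-sided ideals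
`I` with `trA(I) ⊆ I` are `0` and `A`. -/
def IsTraceSimple {K A : Type*} [Field K] [NonUnitalRing A] [Module K A]
    (trA : A →ₗ[K] A) : Prop :=
  (∃ a b : A, a * b ≠ 0) ∧
    ∀ I : Submodule K A, (IsIdeal I ∧ ∀ a ∈ I, trA a ∈ I) → I = ⊥ ∨ I = ⊤

section SimpleAlgebra

variable {K A : Type*} [Field K] [NonUnitalRing A] [Module K A]

/-- **Burnside's theorem**, for a simple module over an algebra. -/
theorem exists_smul_eq_of_isSimpleModule {R V : Type*} [IsAlgClosed K] [Ring R] [Algebra K R]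
    [AddCommGroup V] [Module K V] [Module R V] [IsScalarTower K R V]
    [FiniteDimensional K V] [IsSimpleModule R V] (f : V →ₗ[K] V) :
    ∃ r : R, ∀ v, f v = r • v := by
  have hbij := IsSimpleModule.algebraMap_end_bijective_of_isAlgClosed (A := R) (V := V) K
  let F : Module.End (Module.End R V) V :=
    { toFun := f
      map_add' := f.map_add
      map_smul' := fun g v => by
        obtain ⟨c, rfl⟩ := hbij.2 g
        simp }
  have : Module.Finite (Module.End R V) V :=
    Module.Finite.of_restrictScalars_finite K (Module.End R V) V
  obtain ⟨r, hr⟩ := Module.Finite.toModuleEnd_moduleEnd_surjective (R := R) (M := V) F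
  exact ⟨r, fun v => (LinearMap.congr_fun hr v).symm⟩

/-- A nonzero algebra embedded as a two-sided ideal of the endomorphisms of a finite-dimensional
space is a matrix algebra. -/
theorem exists_linearEquiv_matrix_of_range_ideal {V : Type*} [AddCommGroup V] [Module K V]
    [FiniteDimensional K V] (ρ : A →ₗ[K] Module.End K V) (hρmul : ∀ a b, ρ (a * b) = ρ a * ρ b)
    (hinj : Function.Injective ρ) (hl : ∀ f a, ∃ b, f * ρ a = ρ b)
    (hr : ∀ f a, ∃ b, ρ a * f = ρ b) (hne : ∃ a : A, a ≠ 0) :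
    ∃ n : ℕ, 0 < n ∧ ∃ e : A ≃ₗ[K] Matrix (Fin n) (Fin n) K, ∀ a b, e (a * b) = e a * e b := by
  obtain ⟨a₀, ha₀⟩ := hne
  have hρ₀ : ρ a₀ ≠ 0 := fun h => ha₀ (hinj (by rw [h, map_zero]))
  have hn : 0 < Module.finrank K V := by
    have : Nontrivial V := by
      by_contra h
      rw [not_nontrivial_iff_subsingleton] at h
      exact hρ₀ (LinearMap.ext fun v => Subsingleton.elim _ _)
    exact Module.finrank_pos
  let M := LinearMap.toMatrixAlgEquiv (Module.finBasis K V)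
  have : NeZero (Module.finrank K V) := ⟨hn.ne'⟩
  let I : TwoSidedIdeal (Matrix (Fin (Module.finrank K V)) (Fin (Module.finrank K V)) K) :=
    TwoSidedIdeal.mk' (Set.range fun a => M (ρ a)) ⟨0, by simp⟩
      (by rintro _ _ ⟨a, rfl⟩ ⟨b, rfl⟩; exact ⟨a + b, by simp⟩)
      (by rintro _ ⟨a, rfl⟩; exact ⟨-a, by simp⟩)
      (by
        rintro x _ ⟨a, rfl⟩
        obtain ⟨b, hb⟩ := hl (M.symm x) a
        exact ⟨b, by simp [← hb]⟩)
      (by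
        rintro _ x ⟨a, rfl⟩
        obtain ⟨b, hb⟩ := hr (M.symm x) a
        exact ⟨b, by simp [← hb]⟩)
  have hI : ∀ x, x ∈ I ↔ ∃ a, M (ρ a) = x := fun x =>
    TwoSidedIdeal.mem_mk' _ _ _ _ _ _ _
  have hone : 1 ∈ I := by
    refine IsSimpleRing.one_mem_of_ne_zero_mem I (x := M (ρ a₀)) ?_ ((hI _).2 ⟨_, rfl⟩)
    exact fun h => hρ₀ (M.injective (by rw [h, map_zero]))
  refine ⟨_, hn, LinearEquiv.ofBijective (M.toLinearMap ∘ₗ ρ) ⟨?_, ?_⟩, ?_⟩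
  · exact M.injective.comp hinj
  · intro x
    have : x ∈ I := by simpa using I.mul_mem_left x 1 hone
    exact (hI x).1 this
  · intro a b
    exact (congrArg M (hρmul a b)).trans (map_mul M _ _)

/-- A finite-dimensional simple algebra over an algebraically closed field is a matrix algebra;
no unit is assumed. -/
theorem exists_linearEquiv_matrix [SMulCommClass K A A] [IsScalarTower K A A] [IsAlgClosed K]
    [FiniteDimensional K A]
    (hmul : ∃ a b : A, a * b ≠ 0)
    (hsimple : ∀ I : Submodule K A, IsIdeal I → I = ⊥ ∨ I = ⊤) :
    ∃ n : ℕ, 0 < n ∧ ∃ e : A ≃ₗ[K] Matrix (Fin n) (Fin n) K, ∀ a b, e (a * b) = e a * e b := by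
  obtain ⟨a₀, b₀, hab⟩ := hmul
  have : Nontrivial A := ⟨a₀ * b₀, 0, hab⟩
  let S : Subalgebra K (Module.End K A) :=
    Algebra.adjoin K (Set.range fun a : A => LinearMap.mulLeft K a)
  have hS : ∀ a : A, LinearMap.mulLeft K a ∈ S := fun a => Algebra.subset_adjoin ⟨a, rfl⟩
  have hright : ∀ s ∈ S, ∀ x y : A, s (x * y) = s x * y := by
    intro s hs
    induction hs using Algebra.adjoin_induction with
    | mem s hs => obtain ⟨a, rfl⟩ := hs; intro x y; simp [mul_assoc]
    | algebraMap r => intro x y; simp [Module.algebraMap_end_apply, smul_mul_assoc]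
    | add s t _ _ hs ht => intro x y; simp [hs, ht, add_mul]
    | mul s t _ _ hs ht => intro x y; simp [hs, ht]
  have hleft : ∀ s ∈ S, ∀ a : A, ∃ b : A, ∀ x, a * s x = b * x := by
    intro s hs
    induction hs using Algebra.adjoin_induction with
    | mem s hs => obtain ⟨c, rfl⟩ := hs; intro a; exact ⟨a * c, fun x => by simp [mul_assoc]⟩
    | algebraMap r =>
      intro a
      exact ⟨r • a, fun x => by
        simp [Module.algebraMap_end_apply, smul_mul_assoc, mul_smul_comm]⟩
    | add s t _ _ hs ht =>
      intro a
      obtain ⟨b, hb⟩ := hs a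
      obtain ⟨c, hc⟩ := ht a
      exact ⟨b + c, fun x => by simp [hb, hc, add_mul, mul_add]⟩
    | mul s t _ _ hs ht =>
      intro a
      obtain ⟨b, hb⟩ := hs a
      obtain ⟨c, hc⟩ := ht b
      exact ⟨c, fun x => by simp [hb, hc]⟩
  have : IsArtinian S A := isArtinian_of_tower K inferInstance
  obtain ⟨V, hV, -⟩ := (IsAtomic.eq_bot_or_exists_atom_le (⊤ : Submodule S A)).resolve_left top_ne_bot
  have : IsSimpleModule S V := isSimpleModule_iff_isAtom.2 hV
  have hVmul : ∀ (a : A), ∀ v ∈ V, a * v ∈ V := fun a v hv =>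
    V.smul_mem (⟨LinearMap.mulLeft K a, hS a⟩ : S) hv
  have : FiniteDimensional K V :=
    inferInstanceAs (FiniteDimensional K (V.restrictScalars K))
  let ρ : A →ₗ[K] (V →ₗ[K] V) :=
    { toFun := fun a =>
        { toFun := fun v => ⟨a * v, hVmul a v v.2⟩
          map_add' := fun x y => Subtype.ext (by simp [mul_add])
          map_smul' := fun c x => Subtype.ext (by simp [mul_smul_comm]) }
      map_add' := fun x y => by ext; simp [add_mul]
      map_smul' := fun c x => by ext; simp [smul_mul_assoc] }
  have hρ : ∀ a (v : V), ((ρ a v : V) : A) = a * v := fun _ _ => rfl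
  have hρmul : ∀ a b, ρ (a * b) = ρ a * ρ b := fun a b => by
    ext v; simp [hρ, mul_assoc]
  have hinj : LinearMap.ker ρ = ⊥ := by
    refine (hsimple _ ?_).resolve_right ?_
    · intro a ha b
      rw [LinearMap.mem_ker] at ha
      simp [LinearMap.mem_ker, hρmul, ha]
    · intro htop
      let r : Submodule K A :=
        { carrier := {x | ∀ a, a * x = 0}
          add_mem' := fun hx hy a => by rw [mul_add, hx, hy, add_zero]
          zero_mem' := fun a => mul_zero a
          smul_mem' := fun c x hx a => by rw [mul_smul_comm, hx, smul_zero] }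
      have hr : IsIdeal r := fun x hx b =>
        ⟨fun a => by rw [← mul_assoc, hx, zero_mul], fun a => by rw [← mul_assoc, hx]⟩
      have hVr : ∀ v ∈ V, v ∈ r := fun v hv a => by
        have ha : a ∈ LinearMap.ker ρ := htop ▸ Submodule.mem_top
        rw [LinearMap.mem_ker] at ha
        have := hρ a ⟨v, hv⟩
        simpa [ha] using this.symm
      rcases hsimple r hr with h | h
      · apply hV.1
        rw [eq_bot_iff]
        intro v hv
        have := hVr v hv
        rw [h] at this
        simpa using this
      · have : b₀ ∈ r := h ▸ Submodule.mem_top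
        exact hab (this a₀)
  have hdense : ∀ f : V →ₗ[K] V, ∃ s : S, ∀ v, f v = s • v :=
    fun f => by
    have := exists_smul_eq_of_isSimpleModule (K := K) (R := S) (V := V) f
    exact this
  have hl : ∀ (f : V →ₗ[K] V) a, ∃ b, f * ρ a = ρ b := fun f a => by
    obtain ⟨s, hs⟩ := hdense f
    refine ⟨s.1 a, ?_⟩
    ext v
    have : ((f (ρ a v) : V) : A) = s.1 (a * v) := by rw [hs]; rfl
    rw [Module.End.mul_apply, this, hright _ s.2, hρ]
  have hr : ∀ (f : V →ₗ[K] V) a, ∃ b, ρ a * f = ρ b := fun f a => by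
    obtain ⟨s, hs⟩ := hdense f
    obtain ⟨b, hb⟩ := hleft s.1 s.2 a
    refine ⟨b, ?_⟩
    ext v
    rw [Module.End.mul_apply, hρ, hs, hρ]
    exact hb v
  exact exists_linearEquiv_matrix_of_range_ideal (V := V) ρ hρmul (LinearMap.ker_eq_bot.1 hinj) hl hr
    ⟨a₀ * b₀, hab⟩

end SimpleAlgebra

section Capelli

/-- The monomial `∏ᵢ (zᵢ x_{σ i} wᵢ) · y` in the variables `x = 0, …, d - 1`, `z = d, …, 2 * d - 1`,
`w = 2 * d, …, 3 * d - 1` and `y = 3 * d`. -/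
def capelliTerm (d : ℕ) (σ : Equiv.Perm (Fin d)) : TraceTerm :=
  (List.finRange d).foldr
    (fun (i : Fin d) t => .mu (.mu (.mu (.var (d + i)) (.var (σ i))) (.var (2 * d + i))) t)
    (.var (3 * d))

/-- The Capelli polynomial, alternating in `x₀, …, x_{d-1}`. -/
noncomputable def capelli (K : Type*) [Field K] (d : ℕ) : TraceTerm →₀ K :=
  ∑ σ : Equiv.Perm (Fin d), Finsupp.single (capelliTerm d σ) ((Equiv.Perm.sign σ : ℤ) : K)

variable {K A : Type*} [Field K] [NonUnitalRing A] [Module K A]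

theorem sum_smul_eval_eq_linearCombination (trA : A → A) (v : ℕ → A) (f : TraceTerm →₀ K) :
    (f.sum fun t c => c • TraceTerm.eval trA v t) =
      Finsupp.linearCombination K (TraceTerm.eval trA v) f :=
  (Finsupp.linearCombination_apply K f).symm

theorem eval_capelliTerm (d : ℕ) (trA : A → A) (v : ℕ → A) (σ : Equiv.Perm (Fin d)) :
    (capelliTerm d σ).eval trA v =
      (List.finRange d).foldr (fun (i : Fin d) t => v (d + i) * v (σ i) * v (2 * d + i) * t)
        (v (3 * d)) := by
  rw [capelliTerm]
  induction List.finRange d with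
  | nil => rfl
  | cons i l ih => rw [List.foldr_cons, List.foldr_cons, ← ih]; rfl

theorem not_isTracePI_capelli (trA : A →ₗ[K] A) {d : ℕ} (x z w : Fin d → A) (e : A)
    (he : e ≠ 0) (hee : e * e = e)
    (hx : ∀ i j, z i * x j * w i = if j = i then e else 0) : ¬ IsTracePI trA (capelli K d) := by
  intro h
  let v : ℕ → A := fun n =>
    if h₁ : n < d then x ⟨n, h₁⟩ else
    if h₂ : n - d < d then z ⟨n - d, h₂⟩ else
    if h₃ : n - 2 * d < d then w ⟨n - 2 * d, h₃⟩ else e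
  have hvx : ∀ i : Fin d, v i = x i := fun i => by simp [v]
  have hvz : ∀ i : Fin d, v (d + i) = z i := fun i => by simp [v]
  have hvw : ∀ i : Fin d, v (2 * d + i) = w i := fun i => by
    have h₁ : ¬ 2 * d + (i : ℕ) < d := by omega
    have h₂ : ¬ 2 * d + (i : ℕ) - d < d := by omega
    simp [v, h₁, h₂]
  have hve : v (3 * d) = e := by
    have h₁ : ¬ 3 * d < d := by omega
    have h₂ : ¬ 3 * d - d < d := by omega
    have h₃ : ¬ 3 * d - 2 * d < d := by omega
    simp [v, h₁, h₂, h₃]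
  have hfold : ∀ (σ : Equiv.Perm (Fin d)) (l : List (Fin d)),
      l.foldr (fun (i : Fin d) t => v (d + i) * v (σ i) * v (2 * d + i) * t) (v (3 * d)) =
        if ∀ i ∈ l, σ i = i then e else 0 := by
    intro σ l
    induction l with
    | nil => simp [hve]
    | cons i l ih =>
      rw [List.foldr_cons, ih, hvz, hvx, hvw, hx]
      by_cases hi : σ i = i <;> by_cases hl : ∀ j ∈ l, σ j = j <;>
        simp_all
  have := h v
  rw [sum_smul_eval_eq_linearCombination, capelli, map_sum,
    Finset.sum_eq_single (1 : Equiv.Perm (Fin d))] at this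
  · rw [Finsupp.linearCombination_single, eval_capelliTerm, hfold] at this
    simp [he] at this
  · intro σ _ hσ
    rw [Finsupp.linearCombination_single, eval_capelliTerm, hfold, if_neg, smul_zero]
    intro hall
    exact hσ (Equiv.ext fun i => hall i (List.mem_finRange i))
  · simp

theorem not_isTracePI_capelli_of_linearEquiv_matrix (trA : A →ₗ[K] A) {n : ℕ} (hn : 0 < n)
    (e : A ≃ₗ[K] Matrix (Fin n) (Fin n) K) (he : ∀ a b, e (a * b) = e a * e b) :
    ¬ IsTracePI trA (capelli K (n * n)) := by
  let r : Fin n := ⟨0, hn⟩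
  have hsymm : ∀ a b, e.symm a * e.symm b = e.symm (a * b) := fun a b =>
    e.injective (by simp [he])
  let f : Fin (n * n) ≃ Fin n × Fin n := finProdFinEquiv.symm
  refine not_isTracePI_capelli trA (fun i => e.symm (Matrix.single (f i).1 (f i).2 1))
    (fun i => e.symm (Matrix.single r (f i).1 1)) (fun i => e.symm (Matrix.single (f i).2 r 1))
    (e.symm (Matrix.single r r 1)) ?_ ?_ ?_
  · intro h
    rw [LinearEquiv.map_eq_zero_iff] at h
    simpa using congrFun (congrFun h r) r
  · rw [hsymm, Matrix.single_mul_single_same, mul_one]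
  · intro i j
    rw [hsymm, hsymm]
    split_ifs with h
    · subst h
      simp
    · rw [LinearEquiv.map_eq_zero_iff]
      have h' : f j ≠ f i := fun h' => h (f.injective h')
      by_cases h₁ : (f i).1 = (f j).1
      · have h₂ : (f j).2 ≠ (f i).2 := fun h₂ => h' (Prod.ext h₁.symm h₂)
        rw [h₁, Matrix.single_mul_single_same, Matrix.single_mul_single_of_ne _ _ _ _ h₂]
      · rw [Matrix.single_mul_single_of_ne _ _ _ _ h₁, zero_mul]

variable [SMulCommClass K A A] [IsScalarTower K A A]

/-- The multilinear map `x ↦ ∏ᵢ (zᵢ xᵢ wᵢ)` into the left multiplications of `A`. -/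
noncomputable def sandwichProd (d : ℕ) (z w : Fin d → A) :
    MultilinearMap K (fun _ : Fin d => A) (Module.End K A) :=
  (MultilinearMap.mkPiAlgebraFin K d (Module.End K A)).compLinearMap fun i =>
    LinearMap.mul K A ∘ₗ LinearMap.mulRight K (w i) ∘ₗ LinearMap.mulLeft K (z i)

theorem sandwichProd_apply (d : ℕ) (z w x : Fin d → A) (y : A) :
    sandwichProd (K := K) d z w x y =
      (List.finRange d).foldr (fun i t => z i * x i * w i * t) y := by
  rw [sandwichProd, MultilinearMap.compLinearMap_apply, MultilinearMap.mkPiAlgebraFin_apply,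
    List.ofFn_eq_map]
  induction List.finRange d with
  | nil => rfl
  | cons i l ih => rw [List.map_cons, List.prod_cons, Module.End.mul_apply, ih]; rfl

theorem isTracePI_capelli [FiniteDimensional K A] (trA : A →ₗ[K] A) {d : ℕ}
    (hd : Module.finrank K A < d) : IsTracePI trA (capelli K d) := by
  intro v
  have key : (MultilinearMap.alternatization (sandwichProd (K := K) d
      (fun i => v (d + i)) (fun i => v (2 * d + i)))) (fun i => v i) = 0 := by
    apply AlternatingMap.map_linearDependent
    intro h
    have := h.fintype_card_le_finrank
    rw [Fintype.card_fin] at this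
    omega
  rw [sum_smul_eval_eq_linearCombination, capelli, map_sum]
  rw [MultilinearMap.alternatization_apply] at key
  have := LinearMap.congr_fun key (v (3 * d))
  rw [LinearMap.sum_apply, LinearMap.zero_apply] at this
  rw [← this]
  refine Finset.sum_congr rfl fun σ _ => ?_
  rw [Finsupp.linearCombination_single, eval_capelliTerm, LinearMap.smul_apply,
    MultilinearMap.domDomCongr_apply, sandwichProd_apply, Int.cast_smul_eq_zsmul, Units.smul_def]

end Capelli

section GenericPoint

universe u v w

/-- Two extensions of a field embed into a common field. -/
theorem exists_field_amalgam {F : Type u} {F₁ : Type v} {F₂ : Type w} [Field F] [Field F₁] [Field F₂]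
    (f₁ : F →+* F₁) (f₂ : F →+* F₂) :
    ∃ (L : Type (max v w)) (_ : Field L) (g₁ : F₁ →+* L) (g₂ : F₂ →+* L),
      g₁.comp f₁ = g₂.comp f₂ := by
  let := f₁.toAlgebra
  let := f₂.toAlgebra
  obtain ⟨M, hM⟩ := Ideal.exists_maximal (TensorProduct F F₁ F₂)
  let := Ideal.Quotient.field M
  refine ⟨TensorProduct F F₁ F₂ ⧸ M, inferInstance,
    (Ideal.Quotient.mk M).comp
      (Algebra.TensorProduct.includeLeft (R := F) (S := F) (A := F₁) (B := F₂)).toRingHom,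
    (Ideal.Quotient.mk M).comp
      (Algebra.TensorProduct.includeRight (R := F) (A := F₁) (B := F₂)).toRingHom, ?_⟩
  ext x
  have h₁ := (Algebra.TensorProduct.includeLeft (R := F) (S := F) (A := F₁) (B := F₂)).commutes x
  have h₂ := (Algebra.TensorProduct.includeRight (R := F) (A := F₁) (B := F₂)).commutes x
  exact congrArg (Ideal.Quotient.mk M) (h₁.trans h₂.symm)

open MvPolynomial in
/-- Two polynomial maps satisfying the same relations agree somewhere, away from a prescribed
hypersurface not containing the images. -/
theorem exists_common_value {K J : Type*} {σ τ : Type*} [Field K] [IsAlgClosed K] [Finite σ]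
    [Finite τ] (p : J → MvPolynomial σ K) (q : J → MvPolynomial τ K)
    (h : ∀ f : MvPolynomial J K, aeval p f = 0 ↔ aeval q f = 0)
    (d : MvPolynomial J K) (hd : aeval p d ≠ 0) :
    ∃ (x : σ → K) (z : τ → K), (∀ j, eval x (p j) = eval z (q j)) ∧ eval x (aeval p d) ≠ 0 := by
  let P : MvPolynomial J K →+* MvPolynomial σ K := (aeval p).toRingHom
  let Q : MvPolynomial J K →+* MvPolynomial τ K := (aeval q).toRingHom
  let I : Ideal (MvPolynomial J K) := RingHom.ker P
  have hIQ : I = RingHom.ker Q := Ideal.ext fun f => h f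
  have : I.IsPrime := RingHom.ker_isPrime P
  let P' : MvPolynomial J K ⧸ I →+* MvPolynomial σ K := RingHom.kerLift P
  let Q' : MvPolynomial J K ⧸ I →+* MvPolynomial τ K :=
    (RingHom.kerLift Q).comp (Ideal.quotEquivOfEq hIQ).toRingHom
  have hP' : Function.Injective P' := RingHom.kerLift_injective P
  have hQ' : Function.Injective Q' :=
    (RingHom.kerLift_injective Q).comp (Ideal.quotEquivOfEq hIQ).injective
  have hp₁ : Function.Injective ((algebraMap (MvPolynomial σ K)
      (FractionRing (MvPolynomial σ K))).comp P') :=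
    (IsFractionRing.injective _ _).comp hP'
  have hq₁ : Function.Injective ((algebraMap (MvPolynomial τ K)
      (FractionRing (MvPolynomial τ K))).comp Q') :=
    (IsFractionRing.injective _ _).comp hQ'
  obtain ⟨L, _, g₁, g₂, hg⟩ := exists_field_amalgam
    (IsFractionRing.lift (K := FractionRing (MvPolynomial J K ⧸ I)) hp₁)
    (IsFractionRing.lift (K := FractionRing (MvPolynomial J K ⧸ I)) hq₁)
  let G₁ : MvPolynomial σ K →+* L := g₁.comp (algebraMap _ _)
  let G₂ : MvPolynomial τ K →+* L := g₂.comp (algebraMap _ _)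
  have hG : ∀ f : MvPolynomial J K, G₁ (aeval p f) = G₂ (aeval q f) := fun f => by
    have := RingHom.congr_fun hg (algebraMap _ _ (Ideal.Quotient.mk I f))
    rw [RingHom.comp_apply, RingHom.comp_apply, IsFractionRing.lift_algebraMap,
      IsFractionRing.lift_algebraMap] at this
    exact this
  have hGd : G₁ (aeval p d) ≠ 0 := by
    have : Function.Injective G₁ := g₁.injective.comp (IsFractionRing.injective _ _)
    exact (map_ne_zero_iff _ this).2 hd
  let φ : MvPolynomial ((σ ⊕ τ) ⊕ Unit) K →+* L :=
    eval₂Hom (G₁.comp C) (Sum.elim (Sum.elim (fun s => G₁ (X s)) fun t => G₂ (X t))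
      fun _ => (G₁ (aeval p d))⁻¹)
  have hφ₁ : ∀ f, φ (rename (fun s => .inl (.inl s)) f) = G₁ f := by
    intro f
    have : φ.comp (rename (fun s => .inl (.inl s))).toRingHom = G₁ := by
      ext <;> simp [φ]
    exact RingHom.congr_fun this f
  have hφ₂ : ∀ f, φ (rename (fun t => .inl (.inr t)) f) = G₂ f := by
    intro f
    have : φ.comp (rename (fun t => .inl (.inr t))).toRingHom = G₂ := by
      ext c
      · simpa [φ] using hG (C c)
      · simp [φ]
    exact RingHom.congr_fun this f
  obtain ⟨M, hM, hle⟩ := Ideal.exists_le_maximal _ (RingHom.ker_ne_top φ)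
  obtain ⟨y, rfl⟩ := isMaximal_iff_eq_vanishingIdeal_singleton.1 hM
  have hy : ∀ f, φ f = 0 → eval y f = 0 := fun f hf => by
    simpa [mem_vanishingIdeal_singleton_iff, aeval_eq_eval] using hle hf
  refine ⟨fun s => y (.inl (.inl s)), fun t => y (.inl (.inr t)), fun j => ?_, fun h0 => ?_⟩
  · have := hy (rename (fun s => .inl (.inl s)) (p j) - rename (fun t => .inl (.inr t)) (q j)) (by
      rw [map_sub, hφ₁, hφ₂, sub_eq_zero]
      simpa using hG (X j))
    rw [map_sub, sub_eq_zero, eval_rename, eval_rename] at this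
    exact this
  · have := hy (rename (fun s => .inl (.inl s)) (aeval p d) * X (.inr ()) - 1) (by
      rw [map_sub, map_mul, hφ₁, map_one, sub_eq_zero, coe_eval₂Hom, eval₂_X]
      exact mul_inv_cancel₀ hGd)
    rw [map_sub, map_mul, eval_rename] at this
    rw [show y ∘ (fun s => Sum.inl (Sum.inl s)) = fun s => y (.inl (.inl s)) from rfl, h0] at this
    simp at this

end GenericPoint

section ScalarTrace

variable {K A : Type*} [Field K] [NonUnitalRing A] [Module K A]

/-- `trA` takes scalar values `τ x • e`, where `e` is a unit of `A` and `τ` is a symmetrizing form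
of `A`. -/
structure IsScalarTrace (trA : A →ₗ[K] A) (τ : A →ₗ[K] K) (e : A) : Prop where
  ne_zero : e ≠ 0
  one_mul : ∀ x, e * x = x
  mul_one : ∀ x, x * e = x
  tr_eq : ∀ x, trA x = τ x • e
  symm : ∀ x y, τ (x * y) = τ (y * x)
  nondegenerate : ∀ x, (∀ y, τ (x * y) = 0) → x = 0

variable [SMulCommClass K A A] [IsScalarTower K A A] {trA : A →ₗ[K] A}

theorem eq_tr_mul_of_isTraceSimple
    (hA1 : ∀ x y : A, trA x * y = y * trA x)
    (hA3 : ∀ x y : A, trA (x * trA y) = trA x * trA y) (hAs : IsTraceSimple trA)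
    {z : A} (hz : trA z ≠ 0) (x : A) : ∃ a, x = trA z * a := by
  obtain ⟨⟨a₀, b₀, hab⟩, hI⟩ := hAs
  have dichotomy : ∀ z, (∀ x, trA z * x = 0) ∨ ∀ x, ∃ a, x = trA z * a := by
    intro z
    have hideal : IsIdeal (LinearMap.range (LinearMap.mulLeft K (trA z))) := by
      rintro _ ⟨a, rfl⟩ b
      exact ⟨⟨a * b, by simp [mul_assoc]⟩, ⟨b * a, by simp [← mul_assoc, hA1 z b]⟩⟩
    rcases hI _ ⟨hideal, by
      rintro _ ⟨a, rfl⟩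
      exact ⟨trA a, by simp [hA3, hA1 z]⟩⟩ with h | h
    · left
      intro x
      have : trA z * x ∈ LinearMap.range (LinearMap.mulLeft K (trA z)) := ⟨x, rfl⟩
      rw [h] at this
      simpa using this
    · right
      intro x
      obtain ⟨a, ha⟩ : x ∈ LinearMap.range (LinearMap.mulLeft K (trA z)) := h ▸ Submodule.mem_top
      exact ⟨a, ha.symm⟩
  let N : Submodule K A :=
    { carrier := {c | c ∈ LinearMap.range trA ∧ ∀ x, c * x = 0}
      add_mem' := fun ha hb => ⟨add_mem ha.1 hb.1, fun x => by rw [add_mul, ha.2, hb.2, add_zero]⟩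
      zero_mem' := ⟨zero_mem _, fun x => zero_mul x⟩
      smul_mem' := fun c x hx => ⟨Submodule.smul_mem _ c hx.1, fun y => by
        rw [smul_mul_assoc, hx.2, smul_zero]⟩ }
  have hN : N = ⊥ := by
    refine (hI N ⟨?_, ?_⟩).resolve_right ?_
    · rintro _ ⟨⟨c, rfl⟩, hc⟩ b
      rw [← hA1, hc]
      exact ⟨N.zero_mem, N.zero_mem⟩
    · rintro c ⟨-, hc⟩
      refine ⟨⟨c, rfl⟩, (dichotomy c).resolve_right fun h => hab ?_⟩
      obtain ⟨a, rfl⟩ := h a₀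
      obtain ⟨b, rfl⟩ := h b₀
      rw [hA1, mul_assoc, ← mul_assoc (trA c) (trA c), ← hA3, hc, map_zero, zero_mul, mul_zero]
    · intro h
      have : a₀ ∈ N := h ▸ Submodule.mem_top
      exact hab (this.2 b₀)
  refine (dichotomy z).resolve_left (fun h => hz ?_) x
  have : trA z ∈ N := ⟨⟨z, rfl⟩, h⟩
  rw [hN] at this
  simpa using this

theorem exists_isScalarTrace [IsAlgClosed K] [FiniteDimensional K A]
    (hA1 : ∀ x y : A, trA x * y = y * trA x) (hA2 : ∀ x y : A, trA (x * y) = trA (y * x))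
    (hA3 : ∀ x y : A, trA (x * trA y) = trA x * trA y) (hAs : IsTraceSimple trA)
    (htr : trA ≠ 0) : ∃ (τ : A →ₗ[K] K) (e : A), IsScalarTrace trA τ e := by
  have hsurj := @eq_tr_mul_of_isTraceSimple K A _ _ _ _ _ trA hA1 hA3 hAs
  obtain ⟨⟨a₀, b₀, hab⟩, hI⟩ := hAs
  obtain ⟨z₀, hz₀⟩ : ∃ z, trA z ≠ 0 := by
    by_contra! h
    exact htr (LinearMap.ext h)
  have : Nontrivial (LinearMap.range trA) := ⟨⟨⟨trA z₀, z₀, rfl⟩, 0, fun h => hz₀ (congrArg Subtype.val h)⟩⟩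
  have hscalar : ∀ z, ∃ c : K, ∀ y, trA z * y = c • y := by
    intro z
    have hmaps : ∀ x ∈ LinearMap.range trA, LinearMap.mulLeft K (trA z) x ∈ LinearMap.range trA := by
      rintro _ ⟨w, rfl⟩
      exact ⟨z * trA w, hA3 z w⟩
    obtain ⟨c, hc⟩ := Module.End.exists_eigenvalue ((LinearMap.mulLeft K (trA z)).restrict hmaps)
    obtain ⟨⟨_, w, rfl⟩, hw⟩ := hc.exists_hasEigenvector
    have hw₀ : trA w ≠ 0 := fun h => hw.2 (Subtype.ext h)
    have hw₁ : trA z * trA w = c • trA w := congrArg Subtype.val hw.apply_eq_smul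
    refine ⟨c, fun y => ?_⟩
    obtain ⟨a, rfl⟩ := hsurj hw₀ y
    rw [← mul_assoc, hw₁, smul_mul_assoc]
  choose c hc using hscalar
  have hcancel : ∀ {r s : K} {y : A}, y ≠ 0 → r • y = s • y → r = s := fun hy h =>
    smul_left_injective K hy h
  let τ : A →ₗ[K] K :=
    { toFun := c
      map_add' := fun x y => hcancel hab (by rw [← hc, map_add, add_mul, hc, hc, add_smul])
      map_smul' := fun r x => hcancel hab (by
        rw [← hc, map_smul, smul_mul_assoc, hc, RingHom.id_apply, smul_smul, smul_eq_mul]) }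
  have hcz₀ : c z₀ ≠ 0 := fun h => hab (by
    obtain ⟨a, ha⟩ := hsurj hz₀ (a₀ * b₀)
    rw [ha, hc, h, zero_smul])
  let e : A := (c z₀)⁻¹ • trA z₀
  have he : ∀ x, e * x = x := fun x => by
    rw [smul_mul_assoc, hc, smul_smul, inv_mul_cancel₀ hcz₀, one_smul]
  have he' : ∀ x, x * e = x := fun x => by
    rw [mul_smul_comm, ← hA1, ← smul_mul_assoc, he]
  have he₀ : e ≠ 0 := fun h => hab (by rw [← he (a₀ * b₀), h, zero_mul])
  have htre : ∀ x, trA x = τ x • e := fun x => by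
    rw [← he' (trA x), hc]
    rfl
  have hsymm : ∀ x y, τ (x * y) = τ (y * x) := fun x y =>
    hcancel he₀ (by rw [← htre, ← htre, hA2])
  refine ⟨τ, e, he₀, he, he', htre, hsymm, fun x hx => ?_⟩
  let I : Submodule K A :=
    { carrier := {x | ∀ y, τ (x * y) = 0}
      add_mem' := fun ha hb y => by rw [add_mul, map_add, ha, hb, add_zero]
      zero_mem' := fun y => by rw [zero_mul, map_zero]
      smul_mem' := fun c x hx y => by rw [smul_mul_assoc, map_smul, hx, smul_zero] }
  have hI₀ : I = ⊥ := by
    refine (hI I ⟨?_, ?_⟩).resolve_right ?_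
    · intro x hx b
      exact ⟨fun y => by rw [mul_assoc, hx], fun y => by rw [mul_assoc, hsymm, mul_assoc, hx]⟩
    · intro x hx y
      rw [htre, ← he' x, hx, zero_smul, zero_mul, map_zero]
    · intro h
      have : z₀ ∈ I := h ▸ Submodule.mem_top
      exact hz₀ (by rw [htre, ← he' z₀, this, zero_smul])
  have : x ∈ I := hx
  rw [hI₀] at this
  simpa using this

end ScalarTrace

section TracePolynomial

open MvPolynomial

variable {K A B : Type*} [Field K] [NonUnitalRing A] [Module K A] [NonUnitalRing B] [Module K B]

/-- The trace polynomial obtained by substituting `tr (s j)` for the variables of `f` and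
multiplying by the variable `N`. -/
noncomputable def traceSubst {J : Type*} (s : J → TraceTerm) (N : ℕ) (f : MvPolynomial J K) :
    TraceTerm →₀ K :=
  ∑ m ∈ f.support, Finsupp.single
    ((Finsupp.toMultiset m).toList.foldr (fun j t => .mu (.tr (s j)) t) (.var N)) (coeff m f)

/-- The arguments of the traces determining the structure constants of a basis. -/
def gramTerm (n : ℕ) : (Fin n × Fin n) ⊕ (Fin n × Fin n × Fin n) → TraceTerm :=
  Sum.elim (fun i => .mu (.var i.1) (.var i.2))
    fun i => .mu (.mu (.var i.1) (.var i.2.1)) (.var i.2.2)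

/-- The values `τ (xᵢ xⱼ)` and `τ (xᵢ xⱼ xₖ)`. -/
def gramValue {n : ℕ} (τ : A →ₗ[K] K) (x : Fin n → A) :
    (Fin n × Fin n) ⊕ (Fin n × Fin n × Fin n) → K :=
  Sum.elim (fun i => τ (x i.1 * x i.2)) fun i => τ (x i.1 * x i.2.1 * x i.2.2)

theorem gramValue_eq {n : ℕ} (τ : A →ₗ[K] K) (trA : A → A) (v : ℕ → A) :
    gramValue τ (fun i : Fin n => v i) = fun j => τ ((gramTerm n j).eval trA v) := by
  ext (_ | _) <;> rfl

/-- The polynomials expressing `gramValue` in coordinates. -/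
noncomputable def gramPoly {n m : ℕ} (τ : A →ₗ[K] K) (b : Fin m → A) :
    (Fin n × Fin n) ⊕ (Fin n × Fin n × Fin n) → MvPolynomial (Fin n × Fin m) K :=
  Sum.elim (fun i => ∑ k, ∑ l, X (i.1, k) * X (i.2, l) * C (τ (b k * b l)))
    fun i => ∑ k, ∑ l, ∑ r, X (i.1, k) * X (i.2.1, l) * X (i.2.2, r) * C (τ (b k * b l * b r))

/-- The determinant of the matrix of the `τ (xᵢ xⱼ)`. -/
noncomputable def gramDet (K : Type*) [Field K] (n : ℕ) :
    MvPolynomial ((Fin n × Fin n) ⊕ (Fin n × Fin n × Fin n)) K :=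
  (Matrix.of fun i j => X (Sum.inl (i, j))).det

theorem eval_gramDet {n : ℕ} (y : (Fin n × Fin n) ⊕ (Fin n × Fin n × Fin n) → K) :
    eval y (gramDet K n) = (Matrix.of fun i j => y (Sum.inl (i, j))).det := by
  rw [gramDet, RingHom.map_det]
  congr 1
  ext i j
  simp

theorem eval_aeval_eq {σ J : Type*} (x : σ → K) (p : J → MvPolynomial σ K) (f : MvPolynomial J K) :
    eval x (aeval p f) = eval (fun j => eval x (p j)) f := by
  induction f using MvPolynomial.induction_on with
  | C a => simp
  | add f g hf hg => rw [map_add, map_add, hf, hg, map_add]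
  | mul_X f i hf => rw [map_mul, map_mul, hf, map_mul, aeval_X, eval_X]

theorem IsScalarTrace.det_ne_zero {trA : A →ₗ[K] A} {τ : A →ₗ[K] K} {e : A}
    (h : IsScalarTrace trA τ e) [SMulCommClass K A A] [IsScalarTower K A A] {n : ℕ}
    (b : Module.Basis (Fin n) K A) : (Matrix.of fun i j => τ (b i * b j)).det ≠ 0 := by
  intro h₀
  obtain ⟨v, hv, hv₀⟩ := Matrix.exists_mulVec_eq_zero_iff.2 h₀
  have hy : ∑ j, v j • b j = 0 := by
    refine h.nondegenerate _ fun y => ?_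
    rw [h.symm]
    have : ∀ i, τ (b i * ∑ j, v j • b j) = 0 := fun i => by
      have := congrFun hv₀ i
      simpa [Matrix.mulVec, dotProduct, Finset.mul_sum, mul_smul_comm, mul_comm] using this
    have hb : τ ∘ₗ LinearMap.mulRight K (∑ j, v j • b j) = 0 := b.ext this
    exact LinearMap.congr_fun hb y
  exact hv (funext fun j => Fintype.linearIndependent_iff.1 b.linearIndependent v hy j)

theorem linearIndependent_of_det_ne_zero [SMulCommClass K A A] (τ : A →ₗ[K] K) {n : ℕ}
    (x : Fin n → A)
    (hx : (Matrix.of fun i j => τ (x i * x j)).det ≠ 0) : LinearIndependent K x := by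
  rw [Fintype.linearIndependent_iff]
  intro g hg
  refine congrFun (Matrix.eq_zero_of_mulVec_eq_zero hx (funext fun i => ?_))
  have : τ (x i * ∑ j, g j • x j) = 0 := by rw [hg, mul_zero, map_zero]
  simpa [Matrix.mulVec, dotProduct, Finset.mul_sum, mul_smul_comm, mul_comm] using this

variable [SMulCommClass K A A] [IsScalarTower K A A] [SMulCommClass K B B] [IsScalarTower K B B]

theorem eval_gramPoly {n m : ℕ} (τ : A →ₗ[K] K) (b : Fin m → A) (y : Fin n × Fin m → K)
    (j : (Fin n × Fin n) ⊕ (Fin n × Fin n × Fin n)) :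
    eval y (gramPoly τ b j) = gramValue τ (fun i => ∑ k, y (i, k) • b k) j := by
  rcases j with ⟨i, j⟩ | ⟨i, j, k⟩
  · simp only [gramPoly, gramValue, Sum.elim_inl, map_sum, map_mul, eval_X, eval_C,
      Finset.sum_mul_sum, smul_mul_smul_comm, map_smul, smul_eq_mul]
  · simp only [gramPoly, gramValue, Sum.elim_inr, map_sum, map_mul, eval_X, eval_C]
    rw [Finset.sum_mul_sum]
    simp only [Finset.sum_mul]
    simp only [Finset.mul_sum, smul_mul_smul_comm, map_sum, map_smul, smul_eq_mul]

theorem IsScalarTrace.linearCombination_traceSubst {trA : A →ₗ[K] A} {τ : A →ₗ[K] K} {e : A}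
    (h : IsScalarTrace trA τ e) {J : Type*} (s : J → TraceTerm) (N : ℕ) (f : MvPolynomial J K)
    (v : ℕ → A) :
    Finsupp.linearCombination K (TraceTerm.eval trA v) (traceSubst s N f) =
      eval (fun j => τ ((s j).eval trA v)) f • v N := by
  have hfold : ∀ l : List J,
      (l.foldr (fun j t => TraceTerm.mu (.tr (s j)) t) (.var N)).eval trA v =
        (l.map fun j => τ ((s j).eval trA v)).prod • v N := by
    intro l
    induction l with
    | nil => simp [TraceTerm.eval]
    | cons j l ih =>
      rw [List.foldr_cons, TraceTerm.eval, ih, TraceTerm.eval, h.tr_eq, smul_mul_smul_comm,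
        h.one_mul, List.map_cons, List.prod_cons]
  rw [traceSubst, map_sum, eval_eq, Finset.sum_smul]
  refine Finset.sum_congr rfl fun m _ => ?_
  rw [Finsupp.linearCombination_single, hfold, smul_smul, ← Multiset.prod_coe, ← Multiset.map_coe,
    Multiset.coe_toList, Finsupp.toMultiset_map, Finsupp.prod_toMultiset,
    Finsupp.prod_mapDomain_index (by simp) (by simp [pow_add])]
  rfl

theorem IsScalarTrace.isTracePI_traceSubst_iff [Infinite K] {trA : A →ₗ[K] A} {τ : A →ₗ[K] K}
    {e : A} (h : IsScalarTrace trA τ e) {n m : ℕ} (b : Module.Basis (Fin m) K A)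
    (f : MvPolynomial ((Fin n × Fin n) ⊕ (Fin n × Fin n × Fin n)) K) :
    IsTracePI trA (traceSubst (gramTerm n) n f) ↔ aeval (gramPoly (n := n) τ b) f = 0 := by
  have hPI : IsTracePI trA (traceSubst (gramTerm n) n f) ↔
      ∀ v : ℕ → A, eval (gramValue τ fun i : Fin n => v i) f • v n = 0 := by
    refine forall_congr' fun v => ?_
    rw [sum_smul_eval_eq_linearCombination, h.linearCombination_traceSubst, gramValue_eq τ trA]
  rw [hPI]
  constructor
  · intro hf
    refine MvPolynomial.funext fun y => ?_
    have := hf fun k => if hk : k < n then ∑ l, y (⟨k, hk⟩, l) • b l else e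
    rw [eval_aeval_eq, map_zero]
    simp only [eval_gramPoly]
    simpa [h.ne_zero] using this
  · intro hf v
    have := congrArg (eval fun i : Fin n × Fin m => b.repr (v i.1) i.2) hf
    simp only [eval_aeval_eq, eval_gramPoly, b.sum_repr, map_zero] at this
    rw [show (fun j => gramValue τ (fun i : Fin n => v i) j) = gramValue τ fun i : Fin n => v i
      from rfl] at this
    rw [this, zero_smul]

variable [IsAlgClosed K] [FiniteDimensional K B]
  {trA : A →ₗ[K] A} {τA : A →ₗ[K] K} {eA : A} {trB : B →ₗ[K] B} {τB : B →ₗ[K] K} {eB : B}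

theorem IsScalarTrace.exists_gramValue_eq (hA : IsScalarTrace trA τA eA)
    (hB : IsScalarTrace trB τB eB)
    (hsame : ∀ f : TraceTerm →₀ K, IsTracePI trA f ↔ IsTracePI trB f)
    {n : ℕ} (a : Module.Basis (Fin n) K A) : ∃ (x : Fin n → A) (z : Fin n → B),
      gramValue τA x = gramValue τB z ∧ LinearIndependent K x ∧ LinearIndependent K z := by
  have : Infinite K := IsAlgClosed.instInfinite
  let b := Module.finBasis K B
  have hd : aeval (gramPoly (n := n) τA a) (gramDet K n) ≠ 0 := by
    intro h
    have := congrArg (eval fun i : Fin n × Fin n => a.repr (a i.1) i.2) h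
    simp only [eval_aeval_eq, eval_gramPoly, a.sum_repr, map_zero, eval_gramDet] at this
    exact hA.det_ne_zero a this
  obtain ⟨x, z, hxz, hx⟩ := exists_common_value (gramPoly (n := n) τA a)
    (gramPoly (n := n) τB b) (fun f => by
      rw [← hA.isTracePI_traceSubst_iff, ← hB.isTracePI_traceSubst_iff, hsame]) _ hd
  simp only [eval_gramPoly] at hxz
  rw [eval_aeval_eq, eval_gramDet] at hx
  simp only [eval_gramPoly] at hx
  have hx' := hx
  simp only [hxz] at hx'
  exact ⟨_, _, funext hxz, linearIndependent_of_det_ne_zero τA _ hx,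
    linearIndependent_of_det_ne_zero τB _ hx'⟩

variable [FiniteDimensional K A]

theorem IsScalarTrace.exists_linearEquiv (hA : IsScalarTrace trA τA eA)
    (hB : IsScalarTrace trB τB eB)
    (hsame : ∀ f : TraceTerm →₀ K, IsTracePI trA f ↔ IsTracePI trB f) :
    ∃ φ : A ≃ₗ[K] B, (∀ a b : A, φ (a * b) = φ a * φ b) ∧ ∀ a : A, φ (trA a) = trB (φ a) := by
  obtain ⟨x, z, hxz, hx, hz⟩ := hA.exists_gramValue_eq hB hsame (Module.finBasis K A)
  obtain ⟨-, z', -, -, hz'⟩ :=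
    hB.exists_gramValue_eq hA (fun f => (hsame f).symm) (Module.finBasis K B)
  have hcard : Module.finrank K A = Module.finrank K B :=
    le_antisymm (by simpa using hz.fintype_card_le_finrank)
      (by simpa using hz'.fintype_card_le_finrank)
  have : Nontrivial A := ⟨eA, 0, hA.ne_zero⟩
  have : Nonempty (Fin (Module.finrank K A)) := ⟨⟨0, Module.finrank_pos⟩⟩
  let a := basisOfLinearIndependentOfCardEqFinrank hx (by simp)
  let b := basisOfLinearIndependentOfCardEqFinrank hz (by simpa using hcard)
  have ha : ∀ i, a i = x i := fun i => by simp [a]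
  have hb : ∀ i, b i = z i := fun i => by simp [b]
  let φ : A ≃ₗ[K] B := a.equiv b (Equiv.refl _)
  have hφ : ∀ i, φ (a i) = b i := fun i => by simp [φ]
  have h₂ : ∀ u v, τB (φ u * φ v) = τA (u * v) := by
    have : ((LinearMap.mul K B).compr₂ τB).compl₁₂ φ.toLinearMap φ.toLinearMap =
        (LinearMap.mul K A).compr₂ τA := by
      refine a.ext fun i => a.ext fun j => ?_
      have := congrFun hxz (Sum.inl (i, j))
      change τB (φ (a i) * φ (a j)) = τA (a i * a j)
      rw [hφ, hφ, ha, ha, hb, hb]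
      exact this.symm
    exact fun u v => LinearMap.congr_fun₂ this u v
  have h₃ : ∀ u v w, τB (φ u * φ v * φ w) = τA (u * v * w) := by
    intro u v w
    have h₁ : ∀ i j, τB ∘ₗ LinearMap.mulLeft K (b i * b j) ∘ₗ φ.toLinearMap =
        τA ∘ₗ LinearMap.mulLeft K (a i * a j) := fun i j => a.ext fun k => by
      have := congrFun hxz (Sum.inr (i, j, k))
      change τB (b i * b j * φ (a k)) = τA (a i * a j * a k)
      rw [hφ, ha, ha, ha, hb, hb, hb]
      exact this.symm
    have h₂ : ((LinearMap.mul K B).compr₂ (τB ∘ₗ LinearMap.mulRight K (φ w))).compl₁₂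
          φ.toLinearMap φ.toLinearMap =
        (LinearMap.mul K A).compr₂ (τA ∘ₗ LinearMap.mulRight K w) := by
      refine a.ext fun i => a.ext fun j => ?_
      change τB (φ (a i) * φ (a j) * φ w) = τA (a i * a j * w)
      rw [hφ, hφ]
      exact LinearMap.congr_fun (h₁ i j) w
    exact LinearMap.congr_fun₂ h₂ u v
  have hmul : ∀ u v, φ (u * v) = φ u * φ v := fun u v => by
    refine sub_eq_zero.1 (hB.nondegenerate _ fun y => ?_)
    obtain ⟨w, rfl⟩ := φ.surjective y
    rw [sub_mul, map_sub, h₂, h₃, sub_self]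
  have he : φ eA = eB := by
    obtain ⟨u, hu⟩ := φ.surjective eB
    rw [← hB.mul_one (φ eA), ← hu, ← hmul, hA.one_mul]
  refine ⟨φ, hmul, fun u => ?_⟩
  rw [hA.tr_eq, hB.tr_eq, map_smul, he]
  congr 1
  rw [← hB.mul_one (φ u), ← he, h₂, hA.mul_one]

end TracePolynomial

section ZeroTrace

variable {K A B : Type*} [Field K] [NonUnitalRing A] [Module K A] [NonUnitalRing B] [Module K B]

theorem eq_zero_of_isTracePI_iff {trA : A →ₗ[K] A} {trB : B →ₗ[K] B}
    (hsame : ∀ f : TraceTerm →₀ K, IsTracePI trA f ↔ IsTracePI trB f) (hA : trA = 0) :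
    trB = 0 := by
  have hf : IsTracePI trA (Finsupp.single (.tr (.var 0)) 1) := fun v => by
    simp [TraceTerm.eval, hA]
  ext x
  simpa [TraceTerm.eval] using (hsame _).1 hf fun _ => x

variable [IsAlgClosed K] [SMulCommClass K A A] [IsScalarTower K A A] [FiniteDimensional K A]
  [SMulCommClass K B B] [IsScalarTower K B B] [FiniteDimensional K B]

theorem exists_linearEquiv_of_trace_eq_zero
    (hAs : IsTraceSimple (0 : A →ₗ[K] A)) (hBs : IsTraceSimple (0 : B →ₗ[K] B))
    (hsame : ∀ f : TraceTerm →₀ K,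
      IsTracePI (0 : A →ₗ[K] A) f ↔ IsTracePI (0 : B →ₗ[K] B) f) :
    ∃ φ : A ≃ₗ[K] B, ∀ a b : A, φ (a * b) = φ a * φ b := by
  obtain ⟨n, hn, e, he⟩ := exists_linearEquiv_matrix hAs.1 fun I hI =>
    hAs.2 I ⟨hI, fun _ _ => I.zero_mem⟩
  obtain ⟨m, hm, f, hf⟩ := exists_linearEquiv_matrix hBs.1 fun I hI =>
    hBs.2 I ⟨hI, fun _ _ => I.zero_mem⟩
  have hn' : Module.finrank K A = n * n := by
    simpa using e.finrank_eq.trans (Module.finrank_matrix K K (Fin n) (Fin n))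
  have hm' : Module.finrank K B = m * m := by
    simpa using f.finrank_eq.trans (Module.finrank_matrix K K (Fin m) (Fin m))
  obtain rfl : n = m := by
    rcases lt_trichotomy n m with h | h | h
    · exact absurd ((hsame _).1 (isTracePI_capelli 0 (hn' ▸ Nat.mul_self_lt_mul_self h)))
        (not_isTracePI_capelli_of_linearEquiv_matrix 0 hm f hf)
    · exact h
    · exact absurd ((hsame _).2 (isTracePI_capelli 0 (hm' ▸ Nat.mul_self_lt_mul_self h)))
        (not_isTracePI_capelli_of_linearEquiv_matrix 0 hn e he)
  exact ⟨e.trans f.symm, fun a b => f.injective (by simp [he, hf])⟩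

end ZeroTrace

theorem traceSimple_same_traceIdentities_isomorphic
    (K A B : Type*) [Field K] [IsAlgClosed K]
    [NonUnitalRing A] [Module K A] [SMulCommClass K A A] [IsScalarTower K A A]
    [FiniteDimensional K A]
    [NonUnitalRing B] [Module K B] [SMulCommClass K B B] [IsScalarTower K B B]
    [FiniteDimensional K B]
    (trA : A →ₗ[K] A)
    (hA1 : ∀ x y : A, trA x * y = y * trA x)
    (hA2 : ∀ x y : A, trA (x * y) = trA (y * x))
    (hA3 : ∀ x y : A, trA (x * trA y) = trA x * trA y)
    (trB : B →ₗ[K] B)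
    (hB1 : ∀ x y : B, trB x * y = y * trB x)
    (hB2 : ∀ x y : B, trB (x * y) = trB (y * x))
    (hB3 : ∀ x y : B, trB (x * trB y) = trB x * trB y)
    (hAs : IsTraceSimple trA) (hBs : IsTraceSimple trB)
    (hsame : ∀ f : TraceTerm →₀ K, IsTracePI trA f ↔ IsTracePI trB f) :
    ∃ φ : A ≃ₗ[K] B, (∀ a b : A, φ (a * b) = φ a * φ b) ∧
      ∀ a : A, φ (trA a) = trB (φ a) := by
  by_cases hA : trA = 0
  · have hB : trB = 0 := eq_zero_of_isTracePI_iff hsame hA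
    subst hA hB
    obtain ⟨φ, hφ⟩ := exists_linearEquiv_of_trace_eq_zero hAs hBs hsame
    exact ⟨φ, hφ, fun a => by simp⟩
  · have hB : trB ≠ 0 := fun h => hA (eq_zero_of_isTracePI_iff (fun f => (hsame f).symm) h)
    obtain ⟨τA, eA, h₁⟩ := exists_isScalarTrace hA1 hA2 hA3 hAs hA
    obtain ⟨τB, eB, h₂⟩ := exists_isScalarTrace hB1 hB2 hB3 hBs hB
    exact h₁.exists_linearEquiv h₂ hsame
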